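/- Let p ≥ 2. Then for all x ∈ (0, π_p/2), the chain of inequalities (x/sinh_p(x))^(1+p) < 1/cosh_p(x) < tanh_p(x)/x < sin_p(x)/x < x/sinh_p(x) holds. -/

import Mathlib

open Real Set Filter Topology

/-- Generalized inverse sine: `arcsin_p x = ∫₀ˣ (1 - tᵖ)^(-1/p) dt`. -/
noncomputable def arcsinp (p : ℝ) (x : ℝ) : ℝ := ∫ t in (0:ℝ)..x, (1 - t ^ p) ^ (-1 / p)

/-- Generalized π: `π_p = 2 · arcsin_p 1`. -/
noncomputable def pip (p : ℝ) : ℝ := 2 * arcsinp p 1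

/-- Generalized sine: the inverse of `arcsinp p` (as a map from `[0,1]`). -/
noncomputable def sinp (p : ℝ) : ℝ → ℝ := Function.invFunOn (arcsinp p) (Set.Icc 0 1)

/-- Generalized cosine. -/
noncomputable def cosp (p : ℝ) (x : ℝ) : ℝ := (1 - (sinp p x) ^ p) ^ (1 / p)

/-- Generalized tangent. -/
noncomputable def tanp (p : ℝ) (x : ℝ) : ℝ := sinp p x / cosp p x

/-- Generalized inverse hyperbolic sine: `arsinh_p x = ∫₀ˣ (1 + tᵖ)^(-1/p) dt`. -/
noncomputable def arsinhp (p : ℝ) (x : ℝ) : ℝ := ∫ t in (0:ℝ)..x, (1 + t ^ p) ^ (-1 / p)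

/-- Generalized hyperbolic sine: the inverse of `arsinhp p` (as a map from `[0,∞)`). -/
noncomputable def sinhp (p : ℝ) : ℝ → ℝ := Function.invFunOn (arsinhp p) (Set.Ici 0)

/-- Generalized hyperbolic cosine. -/
noncomputable def coshp (p : ℝ) (x : ℝ) : ℝ := (1 + (sinhp p x) ^ p) ^ (1 / p)

/-- Generalized hyperbolic tangent. -/
noncomputable def tanhp (p : ℝ) (x : ℝ) : ℝ := sinhp p x / coshp p x

lemma aux_inv_deriv {F f g : ℝ → ℝ} {B : ℝ} {D : Set ℝ} (hD : IsOpen D)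
    (hm : StrictMonoOn F D) (hF : ∀ t ∈ D, HasDerivAt F (f t) t) (hf : ∀ t ∈ D, 0 < f t)
    (hg : ∀ x ∈ Set.Ioo 0 B, g x ∈ D ∧ F (g x) = x) :
    ∀ x ∈ Set.Ioo 0 B, HasDerivAt g (f (g x))⁻¹ x := by
  intro x hx
  have hgm : StrictMonoOn g (Set.Ioo 0 B) := by
    intro a ha b hb hab
    by_contra hcon
    have h1 := hm.monotoneOn (hg b hb).1 (hg a ha).1 (not_lt.mp hcon)
    rw [(hg b hb).2, (hg a ha).2] at h1
    linarith
  have himg : g '' (Set.Ioo 0 B) ∈ 𝓝 (g x) := by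
    have hc : ContinuousAt F (g x) := (hF _ (hg x hx).1).continuousAt
    have h1 : F ⁻¹' (Set.Ioo 0 B) ∈ 𝓝 (g x) := by
      apply hc.preimage_mem_nhds
      rw [(hg x hx).2]
      exact isOpen_Ioo.mem_nhds hx
    filter_upwards [h1, hD.mem_nhds (hg x hx).1] with t ht htD
    refine ⟨F t, ht, ?_⟩
    exact hm.injOn (hg _ ht).1 htD (hg _ ht).2
  have hcont : ContinuousAt g x :=
    hgm.continuousAt_of_image_mem_nhds (isOpen_Ioo.mem_nhds hx) himg
  refine HasDerivAt.of_local_left_inverse hcont (hF _ (hg x hx).1) (hf _ (hg x hx).1).ne' ?_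
  filter_upwards [isOpen_Ioo.mem_nhds hx] with y hy
  exact (hg y hy).2

/-! ### arsinhp -/

lemma aux_arsinhp_deriv (p : ℝ) (hp : 2 ≤ p) (y : ℝ) (hy : 0 ≤ y) :
    HasDerivAt (arsinhp p) ((1 + y ^ p) ^ (-1 / p)) y := by
  have hpos : ∀ t : ℝ, 0 ≤ t → (1 + t ^ p) ≠ 0 := fun t ht => by
    have := Real.rpow_nonneg ht p
    positivity
  have hc : ∀ t : ℝ, 0 ≤ t → ContinuousAt (fun t : ℝ => (1 + t ^ p) ^ (-1 / p)) t := by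
    intro t ht
    refine ContinuousAt.rpow_const ?_ (Or.inl (hpos t ht))
    exact continuousAt_const.add (Real.continuousAt_rpow_const _ _ (Or.inr (by linarith)))
  apply intervalIntegral.integral_hasDerivAt_right
  · apply ContinuousOn.intervalIntegrable
    intro t ht
    rw [Set.uIcc_of_le hy] at ht
    exact (hc t ht.1).continuousWithinAt
  · apply MeasureTheory.StronglyMeasurable.stronglyMeasurableAtFilter
    apply Measurable.stronglyMeasurable
    fun_prop
  · exact hc y hy

lemma aux_arsinhp_zero (p : ℝ) : arsinhp p 0 = 0 := by simp [arsinhp]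

lemma aux_arsinhp_cont (p : ℝ) (hp : 2 ≤ p) : ContinuousOn (arsinhp p) (Set.Ici 0) :=
  fun y hy => (aux_arsinhp_deriv p hp y hy).continuousAt.continuousWithinAt

lemma aux_arsinhp_mono (p : ℝ) (hp : 2 ≤ p) : StrictMonoOn (arsinhp p) (Set.Ici 0) := by
  apply strictMonoOn_of_deriv_pos (convex_Ici 0) (aux_arsinhp_cont p hp)
  intro y hy
  rw [interior_Ici] at hy
  rw [(aux_arsinhp_deriv p hp y (le_of_lt hy)).deriv]
  have := Real.rpow_pos_of_pos hy p
  positivity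

/-- comparison principle -/
lemma aux_compare {F G F' G' : ℝ → ℝ} (hF : ∀ y, 0 ≤ y → HasDerivAt F (F' y) y)
    (hG : ∀ y, 0 ≤ y → HasDerivAt G (G' y) y) (h0 : F 0 = G 0)
    (hlt : ∀ y, 0 < y → F' y < G' y) : ∀ y, 0 < y → F y < G y := by
  intro y hy
  have hm : StrictMonoOn (fun y => G y - F y) (Set.Ici 0) := by
    apply strictMonoOn_of_deriv_pos (convex_Ici 0)
    · intro y hy
      exact ((hG y hy).sub (hF y hy)).continuousAt.continuousWithinAt
    · intro y hy
      rw [interior_Ici] at hy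
      have := ((hG y (le_of_lt hy)).sub (hF y (le_of_lt hy))).deriv
      change deriv (G - F) y > 0
      rw [this]
      linarith [hlt y hy]
  have := hm (Set.mem_Ici.mpr le_rfl) (Set.mem_Ici.mpr hy.le) hy
  simp only [h0] at this
  linarith

lemma aux_arsinhp_lt (p : ℝ) (hp : 2 ≤ p) : ∀ y, 0 < y → arsinhp p y < y := by
  apply aux_compare (F' := fun y => (1 + y ^ p) ^ (-1 / p)) (G' := fun _ => 1) (G := fun y => y)
  · exact aux_arsinhp_deriv p hp
  · intro y _; exact hasDerivAt_id y
  · exact aux_arsinhp_zero p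
  · intro y hy
    have := Real.rpow_pos_of_pos hy p
    apply Real.rpow_lt_one_of_one_lt_of_neg
    · linarith
    · rw [neg_div]
      have : 0 < 1 / p := by positivity
      linarith

lemma aux_base_deriv (p c : ℝ) (hp : 2 ≤ p) (y : ℝ) (hy : 0 ≤ y) :
    HasDerivAt (fun y : ℝ => y * (1 + y ^ p) ^ (-c))
      ((1 + y ^ p) ^ (-c - 1) * (1 + (1 - c * p) * y ^ p)) y := by
  have hu : 0 ≤ y ^ p := Real.rpow_nonneg hy p
  have h1 : HasDerivAt (fun y : ℝ => 1 + y ^ p) (p * y ^ (p - 1)) y :=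
    (Real.hasDerivAt_rpow_const (Or.inr (by linarith))).const_add 1
  have h2 := h1.rpow_const (p := -c) (Or.inl (by positivity : (1 + y ^ p) ≠ 0))
  have h3 := (hasDerivAt_id y).mul h2
  refine h3.congr_deriv ?_
  have e1 : y ^ p = y * y ^ (p - 1) := by
    rcases hy.eq_or_lt with h | h
    · rw [← h, Real.zero_rpow (by linarith)]; ring
    · rw [Real.rpow_sub_one h.ne']; field_simp
  have e2 : (1 + y ^ p) ^ (-c) = (1 + y ^ p) ^ (-c - 1) * (1 + y ^ p) := by
    rw [Real.rpow_sub_one (by positivity)]; field_simp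
  simp only [id]
  rw [e2]
  linear_combination ((1 + y ^ p) ^ (-c - 1) * p * c) * e1

lemma aux_arsinhp_lt2 (p : ℝ) (hp : 2 ≤ p) :
    ∀ y, 0 < y → arsinhp p y < y * (1 + y ^ p) ^ (-(1 / (p * (p + 1)))) := by
  apply aux_compare (F' := fun y => (1 + y ^ p) ^ (-1 / p))
    (G' := fun y => (1 + y ^ p) ^ (-(1 / (p * (p + 1))) - 1) *
      (1 + (1 - (1 / (p * (p + 1))) * p) * y ^ p))
  · exact aux_arsinhp_deriv p hp
  · intro y hy; exact aux_base_deriv p _ hp y hy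
  · simp [aux_arsinhp_zero]
  · intro y hy
    have hu := Real.rpow_pos_of_pos hy p
    have hb : (1 + y ^ p) ^ (p / (p + 1)) < 1 + p / (p + 1) * y ^ p := by
      apply rpow_one_add_lt_one_add_mul_self (by linarith) hu.ne' (by positivity)
      rw [div_lt_one (by linarith)]; linarith
    have e : (1 + y ^ p) ^ (-1 / p) =
        (1 + y ^ p) ^ (-(1 / (p * (p + 1))) - 1) * (1 + y ^ p) ^ (p / (p + 1)) := by
      rw [← Real.rpow_add (by positivity)]
      congr 1
      field_simp
      ring
    have e3 : 1 - (1 / (p * (p + 1))) * p = p / (p + 1) := by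
      field_simp
      ring
    simp only [e, e3]
    exact mul_lt_mul_of_pos_left hb (by positivity)

lemma aux_lower (p : ℝ) (hp : 2 ≤ p) :
    ∀ y, 0 < y → y * (1 + y ^ p) ^ (-(1 / p)) < arsinhp p y := by
  apply aux_compare (G' := fun y => (1 + y ^ p) ^ (-1 / p))
    (F' := fun y => (1 + y ^ p) ^ (-(1 / p) - 1) * (1 + (1 - (1 / p) * p) * y ^ p))
  · intro y hy; exact aux_base_deriv p _ hp y hy
  · exact aux_arsinhp_deriv p hp
  · simp [aux_arsinhp_zero]
  · intro y hy
    have hu := Real.rpow_pos_of_pos hy p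
    have e3 : 1 - (1 / p) * p = 0 := by
      field_simp
      ring
    simp only [e3, zero_mul, add_zero, mul_one]
    apply Real.rpow_lt_rpow_of_exponent_lt (by linarith)
    rw [neg_div]; linarith

lemma aux_log (p : ℝ) (hp : 2 ≤ p) : ∀ y, 0 ≤ y → Real.log (1 + y) ≤ arsinhp p y := by
  intro y hy
  have hm : MonotoneOn (fun y => arsinhp p y - Real.log (1 + y)) (Set.Ici 0) := by
    have hd : ∀ y : ℝ, 0 ≤ y → HasDerivAt (fun y => arsinhp p y - Real.log (1 + y))
        ((1 + y ^ p) ^ (-1 / p) - 1 / (1 + y)) y := by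
      intro y hy
      exact (aux_arsinhp_deriv p hp y hy).sub
        (((hasDerivAt_id y).const_add 1).log (by simp only [id]; positivity))
    apply monotoneOn_of_deriv_nonneg (convex_Ici 0)
    · intro y hy
      exact (hd y hy).continuousAt.continuousWithinAt
    · intro y hy
      rw [interior_Ici] at hy
      exact (hd y (le_of_lt hy)).differentiableAt.differentiableWithinAt
    · intro y hy
      rw [interior_Ici] at hy
      have hy : 0 < y := hy
      rw [(hd y hy.le).deriv, sub_nonneg]
      have h1 : 1 + y ^ p ≤ (1 + y) ^ p := by
        have := Real.add_rpow_le_rpow_add (a := 1) (b := y) (p := p) (by norm_num) hy.le (by linarith)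
        simpa using this
      have h2 := Real.rpow_le_rpow_of_nonpos (x := 1 + y ^ p) (y := (1 + y) ^ p) (z := -1 / p)
        (by have := Real.rpow_pos_of_pos hy p; positivity) h1
        (by apply div_nonpos_of_nonpos_of_nonneg <;> linarith)
      rw [← Real.rpow_mul (by positivity)] at h2
      have e : p * (-1 / p) = -1 := by field_simp
      rw [e, Real.rpow_neg_one] at h2
      rw [one_div]
      exact h2
  have := hm (Set.mem_Ici.mpr le_rfl) (Set.mem_Ici.mpr hy) hy
  simp [aux_arsinhp_zero] at this
  linarith

lemma aux_sinhp (p : ℝ) (hp : 2 ≤ p) (x : ℝ) (hx : 0 < x) :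
    0 < sinhp p x ∧ arsinhp p (sinhp p x) = x := by
  have hex : ∃ y ∈ Set.Ici (0:ℝ), arsinhp p y = x := by
    have hle : (0:ℝ) ≤ Real.exp x - 1 := by linarith [Real.add_one_le_exp x]
    have := intermediate_value_Icc hle ((aux_arsinhp_cont p hp).mono Set.Icc_subset_Ici_self)
    have hx2 : x ∈ Set.Icc (arsinhp p 0) (arsinhp p (Real.exp x - 1)) := by
      refine ⟨by rw [aux_arsinhp_zero]; exact hx.le, ?_⟩
      have := aux_log p hp _ hle
      simpa using this
    obtain ⟨y, hy, h⟩ := this hx2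
    exact ⟨y, hy.1, h⟩
  have h1 : sinhp p x ∈ Set.Ici (0:ℝ) := Function.invFunOn_mem hex
  have h2 : arsinhp p (sinhp p x) = x := Function.invFunOn_eq hex
  refine ⟨lt_of_le_of_ne h1 ?_, h2⟩
  intro h
  rw [← h, aux_arsinhp_zero] at h2
  exact hx.ne h2

lemma aux_sinhp_deriv (p : ℝ) (hp : 2 ≤ p) (x : ℝ) (hx : 0 < x) :
    HasDerivAt (sinhp p) ((1 + (sinhp p x) ^ p) ^ (-1 / p))⁻¹ x := by
  refine aux_inv_deriv (F := arsinhp p) (f := fun y => (1 + y ^ p) ^ (-1 / p)) (B := x + 1)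
    (D := Set.Ioi 0) isOpen_Ioi ((aux_arsinhp_mono p hp).mono Set.Ioi_subset_Ici_self)
    (fun t ht => aux_arsinhp_deriv p hp t (le_of_lt ht)) ?_ ?_ x ⟨hx, by linarith⟩
  · intro t ht
    have := Real.rpow_pos_of_pos ht p
    positivity
  · intro z hz
    exact aux_sinhp p hp z hz.1

/-! ### arcsinp -/

lemma aux_arcsinp_zero (p : ℝ) : arcsinp p 0 = 0 := by simp [arcsinp]

lemma aux_int (p : ℝ) (hB : 0 < arcsinp p 1) :
    IntervalIntegrable (fun t : ℝ => (1 - t ^ p) ^ (-1 / p)) MeasureTheory.volume 0 1 := by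
  by_contra h
  have := intervalIntegral.integral_undef h
  rw [arcsinp, this] at hB
  exact lt_irrefl _ hB

lemma aux_lt_one (p : ℝ) (hp : 2 ≤ p) {t : ℝ} (h0 : 0 ≤ t) (ht : t < 1) : t ^ p < 1 :=
  Real.rpow_lt_one h0 ht (by linarith)

lemma aux_arcsinp_deriv (p : ℝ) (hp : 2 ≤ p) (y : ℝ) (hy : 0 ≤ y) (hy1 : y < 1) :
    HasDerivAt (arcsinp p) ((1 - y ^ p) ^ (-1 / p)) y := by
  have hc : ∀ t : ℝ, 0 ≤ t → t < 1 →
      ContinuousAt (fun t : ℝ => (1 - t ^ p) ^ (-1 / p)) t := by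
    intro t ht ht1
    refine ContinuousAt.rpow_const ?_ (Or.inl (by linarith [aux_lt_one p hp ht ht1]))
    exact continuousAt_const.sub (Real.continuousAt_rpow_const _ _ (Or.inr (by linarith)))
  apply intervalIntegral.integral_hasDerivAt_right
  · apply ContinuousOn.intervalIntegrable
    intro t ht
    rw [Set.uIcc_of_le hy] at ht
    exact (hc t ht.1 (lt_of_le_of_lt ht.2 hy1)).continuousWithinAt
  · apply MeasureTheory.StronglyMeasurable.stronglyMeasurableAtFilter
    apply Measurable.stronglyMeasurable
    fun_prop
  · exact hc y hy hy1

lemma aux_arcsinp_cont (p : ℝ) (hB : 0 < arcsinp p 1) :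
    ContinuousOn (arcsinp p) (Set.Icc 0 1) := by
  have h := intervalIntegral.continuousOn_primitive_interval' (a := 0) (aux_int p hB)
    (by simp)
  rw [Set.uIcc_of_le (by norm_num)] at h
  exact h

lemma aux_arcsinp_mono (p : ℝ) (hp : 2 ≤ p) (hB : 0 < arcsinp p 1) :
    StrictMonoOn (arcsinp p) (Set.Icc 0 1) := by
  apply strictMonoOn_of_deriv_pos (convex_Icc 0 1) (aux_arcsinp_cont p hB)
  intro y hy
  rw [interior_Icc] at hy
  rw [(aux_arcsinp_deriv p hp y hy.1.le hy.2).deriv]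
  have : 0 < 1 - y ^ p := by linarith [aux_lt_one p hp hy.1.le hy.2]
  positivity

lemma aux_sinp (p : ℝ) (hB : 0 < arcsinp p 1) (x : ℝ)
    (hx : x ∈ Set.Ioo 0 (arcsinp p 1)) :
    sinp p x ∈ Set.Ioo (0:ℝ) 1 ∧ arcsinp p (sinp p x) = x := by
  have hex : ∃ y ∈ Set.Icc (0:ℝ) 1, arcsinp p y = x := by
    have := intermediate_value_Icc (zero_le_one) (aux_arcsinp_cont p hB)
    exact this ⟨by rw [aux_arcsinp_zero]; exact hx.1.le, hx.2.le⟩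
  have h1 : sinp p x ∈ Set.Icc (0:ℝ) 1 := Function.invFunOn_mem hex
  have h2 : arcsinp p (sinp p x) = x := Function.invFunOn_eq hex
  refine ⟨⟨lt_of_le_of_ne h1.1 ?_, lt_of_le_of_ne h1.2 ?_⟩, h2⟩
  · intro h
    rw [← h, aux_arcsinp_zero] at h2
    exact hx.1.ne h2
  · intro h
    rw [h] at h2
    exact hx.2.ne' h2

lemma aux_sinp_deriv (p : ℝ) (hp : 2 ≤ p) (hB : 0 < arcsinp p 1) (x : ℝ)
    (hx : x ∈ Set.Ioo 0 (arcsinp p 1)) :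
    HasDerivAt (sinp p) ((1 - (sinp p x) ^ p) ^ (-1 / p))⁻¹ x := by
  refine aux_inv_deriv (F := arcsinp p) (f := fun y => (1 - y ^ p) ^ (-1 / p))
    (B := arcsinp p 1)
    (D := Set.Ioo 0 1) isOpen_Ioo ((aux_arcsinp_mono p hp hB).mono Set.Ioo_subset_Icc_self)
    (fun t ht => aux_arcsinp_deriv p hp t ht.1.le ht.2) ?_ ?_ x hx
  · intro t ht
    have : 0 < 1 - t ^ p := by linarith [aux_lt_one p hp ht.1.le ht.2]
    positivity
  · intro z hz
    exact aux_sinp p hB z hz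

/-! ### tanh < sin -/

lemma aux_T_pow (p : ℝ) (hp : 2 ≤ p) (y : ℝ) (hy : 0 ≤ y) :
    (y * (1 + y ^ p) ^ (-(1 / p))) ^ p = 1 - (1 + y ^ p)⁻¹ := by
  have hu := Real.rpow_nonneg hy p
  rw [Real.mul_rpow hy (by positivity), ← Real.rpow_mul (by positivity)]
  have e : -(1 / p) * p = -1 := by field_simp
  rw [e, Real.rpow_neg_one]
  field_simp
  ring

lemma aux_T_lt (p : ℝ) (hp : 2 ≤ p) (y : ℝ) (hy : 0 ≤ y) :
    y * (1 + y ^ p) ^ (-(1 / p)) < 1 := by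
  have hu := Real.rpow_nonneg hy p
  have h := aux_T_pow p hp y hy
  by_contra hcon
  have h1 := Real.one_le_rpow (not_lt.mp hcon) (by linarith : 0 ≤ p)
  have : 0 < (1 + y ^ p)⁻¹ := by positivity
  linarith

lemma aux_arcsin_T (p : ℝ) (hp : 2 ≤ p) :
    ∀ y, 0 < y → arcsinp p (y * (1 + y ^ p) ^ (-(1 / p))) < arsinhp p y := by
  apply aux_compare (G' := fun y => (1 + y ^ p) ^ (-1 / p))
    (F := fun y => arcsinp p (y * (1 + y ^ p) ^ (-(1 / p))))
    (F' := fun y => (1 - (y * (1 + y ^ p) ^ (-(1 / p))) ^ p) ^ (-1 / p) *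
      ((1 + y ^ p) ^ (-(1 / p) - 1) * (1 + (1 - (1 / p) * p) * y ^ p)))
  · intro y hy
    have hu := Real.rpow_nonneg hy p
    have h1 := aux_base_deriv p (1 / p) hp y hy
    have h2 := aux_arcsinp_deriv p hp (y * (1 + y ^ p) ^ (-(1 / p))) (by positivity)
      (aux_T_lt p hp y hy)
    exact HasDerivAt.comp y h2 h1
  · exact aux_arsinhp_deriv p hp
  · simp [aux_arsinhp_zero, aux_arcsinp_zero]
  · intro y hy
    have hu := Real.rpow_pos_of_pos hy p
    have e3 : 1 - (1 / p) * p = 0 := by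
      field_simp
      ring
    simp only [e3, zero_mul, add_zero, mul_one]
    rw [aux_T_pow p hp y hy.le, sub_sub_cancel, ← Real.rpow_neg_one, ← Real.rpow_mul (by positivity),
      ← Real.rpow_add (by positivity)]
    apply Real.rpow_lt_rpow_of_exponent_lt (by linarith)
    have : 1 / p < 1 := by rw [div_lt_one] <;> linarith
    rw [neg_div]; linarith

lemma aux_T_lt_sin (p : ℝ) (hp : 2 ≤ p) (hB : 0 < arcsinp p 1) (x : ℝ)
    (hx : x ∈ Set.Ioo 0 (arcsinp p 1)) :
    sinhp p x * (1 + sinhp p x ^ p) ^ (-(1 / p)) < sinp p x := by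
  obtain ⟨hy, hy2⟩ := aux_sinhp p hp x hx.1
  obtain ⟨hs, hs2⟩ := aux_sinp p hB x hx
  have h := aux_arcsin_T p hp _ hy
  rw [hy2] at h
  by_contra hcon
  have hu := Real.rpow_pos_of_pos hy p
  have := (aux_arcsinp_mono p hp hB).monotoneOn ⟨hs.1.le, hs.2.le⟩
    ⟨by positivity, (aux_T_lt p hp _ hy.le).le⟩ (not_lt.mp hcon)
  rw [hs2] at this
  linarith

/-! ### cotangents -/

/-- derivative of the cotangent-like functions: `e = -1` circular, `e = 1` hyperbolic -/
lemma aux_cot_deriv (p e : ℝ) (hp : 2 ≤ p) (g : ℝ → ℝ) (x : ℝ) (hg : 0 < g x)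
    (hpos : 0 < 1 + e * g x ^ p)
    (hd : HasDerivAt g ((1 + e * (g x) ^ p) ^ (-1 / p))⁻¹ x) :
    HasDerivAt (fun x => (g x ^ (-p) + e) ^ (1 / p))
      (- ((g x ^ (-p) + e) ^ (1 / p)) ^ 2 + e * ((g x ^ (-p) + e) ^ (1 / p)) ^ (2 - p)) x
    ∧ ((1 + e * (g x) ^ p) ^ (-1 / p))⁻¹ = g x * (g x ^ (-p) + e) ^ (1 / p) := by
  have hs : 0 < g x ^ (-p) := Real.rpow_pos_of_pos hg _
  have hsp : 0 < g x ^ p := Real.rpow_pos_of_pos hg _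
  have hss : g x ^ p * g x ^ (-p) = 1 := by
    rw [← Real.rpow_add hg]; simp
  have hw : 0 < g x ^ (-p) + e := by
    have : g x ^ (-p) + e = g x ^ (-p) * (1 + e * g x ^ p) := by
      linear_combination (-e) * hss
    rw [this]; positivity
  have hder : ((1 + e * (g x) ^ p) ^ (-1 / p))⁻¹ = g x * (g x ^ (-p) + e) ^ (1 / p) := by
    have h1 : 1 + e * g x ^ p = g x ^ p * (g x ^ (-p) + e) := by
      linear_combination (-1) * hss
    rw [neg_div, Real.rpow_neg hpos.le, inv_inv, h1, Real.mul_rpow hsp.le hw.le,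
      ← Real.rpow_mul hg.le]
    have : p * (1 / p) = 1 := by field_simp
    rw [this, Real.rpow_one]
  refine ⟨?_, hder⟩
  rw [hder] at hd
  have h1 := hd.rpow_const (p := -p) (Or.inl hg.ne')
  have h2 := (h1.add_const e).rpow_const (p := 1 / p) (Or.inl hw.ne')
  refine h2.congr_deriv ?_
  set w := g x ^ (-p) + e with hwdef
  have e1 : (w ^ (1 / p)) ^ 2 = w ^ (1 / p) * w ^ (1 / p) := by ring
  have e2 : (w ^ (1 / p)) ^ (2 - p) = w ^ (1 / p) * w ^ (1 / p - 1) := by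
    rw [← Real.rpow_mul hw.le, ← Real.rpow_add hw]
    congr 1
    field_simp
    ring
  have e3 : g x ^ (-p - 1) * g x = g x ^ (-p) := by
    rw [Real.rpow_sub_one hg.ne']; field_simp
  have e4 : w ^ (1 / p) = w ^ (1 / p - 1) * w := by
    rw [Real.rpow_sub_one hw.ne']; field_simp
  have e5 : g x ^ (-p) = w - e := by rw [hwdef]; ring
  rw [e1, e2]
  have e6 : g x * w ^ (1 / p) * -p * g x ^ (-p - 1) * (1 / p) * w ^ (1 / p - 1)
      = - (w ^ (1 / p)) * w ^ (1 / p - 1) * (g x ^ (-p - 1) * g x) := by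
    field_simp
  rw [e6, e3, e5]
  linear_combination (-(w ^ (1 / p))) * (-e4)

/-- circular cotangent -/
noncomputable def auxA (p x : ℝ) : ℝ := (sinp p x ^ (-p) + (-1)) ^ (1 / p)
/-- hyperbolic cotangent -/
noncomputable def auxB (p x : ℝ) : ℝ := (sinhp p x ^ (-p) + 1) ^ (1 / p)

lemma aux_A (p : ℝ) (hp : 2 ≤ p) (hB : 0 < arcsinp p 1) (x : ℝ)
    (hx : x ∈ Set.Ioo 0 (arcsinp p 1)) :
    HasDerivAt (auxA p) (- (auxA p x) ^ 2 - (auxA p x) ^ (2 - p)) x ∧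
    HasDerivAt (sinp p) (sinp p x * auxA p x) x := by
  obtain ⟨hs, hs2⟩ := aux_sinp p hB x hx
  have hd := aux_sinp_deriv p hp hB x hx
  have e : 1 - sinp p x ^ p = 1 + (-1) * sinp p x ^ p := by ring
  have h1 := aux_lt_one p hp hs.1.le hs.2
  rw [e] at hd
  obtain ⟨h2, h3⟩ := aux_cot_deriv p (-1) hp (sinp p) x hs.1 (by linarith) hd
  refine ⟨h2.congr_deriv ?_, ?_⟩
  · simp only [auxA]; ring
  · rw [h3] at hd; exact hd

lemma aux_B (p : ℝ) (hp : 2 ≤ p) (x : ℝ) (hx : 0 < x) :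
    HasDerivAt (auxB p) (- (auxB p x) ^ 2 + (auxB p x) ^ (2 - p)) x ∧
    HasDerivAt (sinhp p) (sinhp p x * auxB p x) x := by
  obtain ⟨hs, hs2⟩ := aux_sinhp p hp x hx
  have hd := aux_sinhp_deriv p hp x hx
  have e : 1 + sinhp p x ^ p = 1 + 1 * sinhp p x ^ p := by ring
  have h1 := Real.rpow_pos_of_pos hs p
  rw [e] at hd
  obtain ⟨h2, h3⟩ := aux_cot_deriv p 1 hp (sinhp p) x hs (by linarith) hd
  refine ⟨h2.congr_deriv ?_, ?_⟩
  · simp only [auxB]; ring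
  · rw [h3] at hd; exact hd

lemma aux_AB (p : ℝ) (hp : 2 ≤ p) (hB : 0 < arcsinp p 1) (x : ℝ)
    (hx : x ∈ Set.Ioo 0 (arcsinp p 1)) : 0 < auxA p x ∧ auxA p x < auxB p x := by
  obtain ⟨hs, hs2⟩ := aux_sinp p hB x hx
  obtain ⟨hy, hy2⟩ := aux_sinhp p hp x hx.1
  have hT := aux_T_lt_sin p hp hB x hx
  have hu := Real.rpow_pos_of_pos hy p
  have hsp := Real.rpow_pos_of_pos hs.1 p
  have h1 := aux_lt_one p hp hs.1.le hs.2
  have hTp := aux_T_pow p hp _ hy.le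
  have h2 := Real.rpow_lt_rpow (by positivity) hT (by linarith : 0 < p)
  rw [hTp] at h2
  have hA : 0 < sinp p x ^ (-p) + (-1) := by
    rw [Real.rpow_neg hs.1.le]
    have := (one_lt_inv₀ hsp).mpr h1
    linarith
  refine ⟨Real.rpow_pos_of_pos hA _, ?_⟩
  apply Real.rpow_lt_rpow hA.le _ (by positivity)
  rw [Real.rpow_neg hs.1.le, Real.rpow_neg hy.le]
  have h3 : 1 - (1 + sinhp p x ^ p)⁻¹ = (1 + (sinhp p x ^ p)⁻¹)⁻¹ := by
    field_simp
    ring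
  rw [h3] at h2
  have h4 := (inv_lt_comm₀ (by positivity) hsp).mp h2
  linarith

lemma aux_sum_lt (p : ℝ) (hp : 2 ≤ p) (hB : 0 < arcsinp p 1) (x : ℝ)
    (hx : x ∈ Set.Ioo 0 (arcsinp p 1)) : auxA p x + auxB p x < 2 / x := by
  have hm : StrictMonoOn (fun x => 2 * (auxA p x + auxB p x)⁻¹ - x)
      (Set.Ioo 0 (arcsinp p 1)) := by
    have hd : ∀ x ∈ Set.Ioo 0 (arcsinp p 1),
        HasDerivAt (fun x => 2 * (auxA p x + auxB p x)⁻¹ - x)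
        (2 * (-((- (auxA p x) ^ 2 - (auxA p x) ^ (2 - p)) +
          (- (auxB p x) ^ 2 + (auxB p x) ^ (2 - p))) / (auxA p x + auxB p x) ^ 2) - 1) x := by
      intro x hx
      obtain ⟨h1, h2⟩ := aux_AB p hp hB x hx
      exact ((((aux_A p hp hB x hx).1.add (aux_B p hp x hx.1).1).inv
        (by simp only [Pi.add_apply]; linarith)).const_mul 2).sub (hasDerivAt_id x)
    apply strictMonoOn_of_deriv_pos (convex_Ioo _ _)
    · intro x hx
      exact (hd x hx).continuousAt.continuousWithinAt
    · intro x hx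
      rw [interior_Ioo] at hx
      rw [(hd x hx).deriv]
      obtain ⟨h1, h2⟩ := aux_AB p hp hB x hx
      have h3 := Real.rpow_le_rpow_of_nonpos h1 h2.le (by linarith : 2 - p ≤ 0)
      have h4 : 0 < (auxA p x + auxB p x) ^ 2 := by
        have : 0 < auxA p x + auxB p x := by linarith
        positivity
      rw [sub_pos, ← mul_div_assoc, lt_div_iff₀ h4]
      have : 0 < (auxB p x - auxA p x) ^ 2 := by
        have : 0 < auxB p x - auxA p x := by linarith
        positivity
      nlinarith
  have hhalf : ∀ ε ∈ Set.Ioo 0 x, -ε < 2 * (auxA p x + auxB p x)⁻¹ - x := by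
    intro ε hε
    have hε2 : ε ∈ Set.Ioo 0 (arcsinp p 1) := ⟨hε.1, hε.2.trans hx.2⟩
    have h := hm hε2 hx hε.2
    obtain ⟨h1, h2⟩ := aux_AB p hp hB ε hε2
    have : 0 < (auxA p ε + auxB p ε)⁻¹ := by
      apply inv_pos.mpr; linarith
    simp only at h
    linarith
  have hge : ∀ z ∈ Set.Ioo 0 (arcsinp p 1), 0 ≤ 2 * (auxA p z + auxB p z)⁻¹ - z := by
    intro z hz
    by_contra hcon
    push Not at hcon
    set d := 2 * (auxA p z + auxB p z)⁻¹ - z with hdd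
    have hε : min (z / 2) (-d) ∈ Set.Ioo 0 z :=
      ⟨lt_min (by linarith [hz.1]) (by linarith),
        lt_of_le_of_lt (min_le_left _ _) (by linarith [hz.1])⟩
    have hε2 : min (z / 2) (-d) ∈ Set.Ioo 0 (arcsinp p 1) := ⟨hε.1, hε.2.trans hz.2⟩
    have h := hm hε2 hz hε.2
    obtain ⟨h1, h2⟩ := aux_AB p hp hB _ hε2
    have : 0 < (auxA p (min (z / 2) (-d)) + auxB p (min (z / 2) (-d)))⁻¹ := by
      apply inv_pos.mpr; linarith
    have h5 := min_le_right (z / 2) (-d)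
    simp only at h
    linarith
  have hx2 : x / 2 ∈ Set.Ioo 0 (arcsinp p 1) := ⟨by linarith [hx.1], by linarith [hx.1, hx.2]⟩
  have h := hm hx2 hx (by linarith [hx.1])
  have h0 := hge _ hx2
  obtain ⟨h1, h2⟩ := aux_AB p hp hB x hx
  simp only at h
  have h6 : x < 2 * (auxA p x + auxB p x)⁻¹ := by linarith
  rw [← div_eq_mul_inv, lt_div_iff₀ (by linarith)] at h6
  rw [lt_div_iff₀ hx.1]
  linarith

lemma aux_sinp_le (p : ℝ) (hp : 2 ≤ p) (hB : 0 < arcsinp p 1) (x : ℝ)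
    (hx : x ∈ Set.Ioo 0 (arcsinp p 1)) : sinp p x ≤ x := by
  obtain ⟨hs, hs2⟩ := aux_sinp p hB x hx
  have hm : MonotoneOn (fun y => arcsinp p y - y) (Set.Ico 0 1) := by
    have hd : ∀ y ∈ Set.Ico (0:ℝ) 1, HasDerivAt (fun y => arcsinp p y - y)
        ((1 - y ^ p) ^ (-1 / p) - 1) y := by
      intro y hy
      exact (aux_arcsinp_deriv p hp y hy.1 hy.2).sub (hasDerivAt_id y)
    apply monotoneOn_of_deriv_nonneg (convex_Ico 0 1)
    · intro y hy
      exact (hd y hy).continuousAt.continuousWithinAt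
    · intro y hy
      exact (hd y (interior_subset hy)).differentiableAt.differentiableWithinAt
    · intro y hy
      have hy := interior_subset hy
      rw [(hd y hy).deriv, sub_nonneg]
      apply Real.one_le_rpow_of_pos_of_le_one_of_nonpos
      · linarith [aux_lt_one p hp hy.1 hy.2]
      · linarith [Real.rpow_nonneg hy.1 p]
      · apply div_nonpos_of_nonpos_of_nonneg <;> linarith
  have := hm (Set.mem_Ico.mpr ⟨le_rfl, zero_lt_one⟩) ⟨hs.1.le, hs.2⟩ hs.1.le
  simp only [aux_arcsinp_zero, hs2] at this
  linarith

lemma aux_prod (p : ℝ) (hp : 2 ≤ p) (hB : 0 < arcsinp p 1) (x : ℝ)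
    (hx : x ∈ Set.Ioo 0 (arcsinp p 1)) : sinp p x * sinhp p x < x * x := by
  have hm : StrictAntiOn (fun x => Real.log (sinp p x) + Real.log (sinhp p x) - 2 * Real.log x)
      (Set.Ioo 0 (arcsinp p 1)) := by
    have hd : ∀ x ∈ Set.Ioo 0 (arcsinp p 1),
        HasDerivAt (fun x => Real.log (sinp p x) + Real.log (sinhp p x) - 2 * Real.log x)
        (sinp p x * auxA p x / sinp p x + sinhp p x * auxB p x / sinhp p x - 2 * x⁻¹) x := by
      intro x hx
      exact (((aux_A p hp hB x hx).2.log (aux_sinp p hB x hx).1.1.ne').add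
        ((aux_B p hp x hx.1).2.log (aux_sinhp p hp x hx.1).1.ne')).sub
        ((Real.hasDerivAt_log hx.1.ne').const_mul 2)
    apply strictAntiOn_of_deriv_neg (convex_Ioo _ _)
    · intro x hx
      exact (hd x hx).continuousAt.continuousWithinAt
    · intro x hx
      rw [interior_Ioo] at hx
      rw [(hd x hx).deriv, mul_div_cancel_left₀ _ (aux_sinp p hB x hx).1.1.ne',
        mul_div_cancel_left₀ _ (aux_sinhp p hp x hx.1).1.ne', ← div_eq_mul_inv]
      linarith [aux_sum_lt p hp hB x hx]
  set P := fun x => Real.log (sinp p x) + Real.log (sinhp p x) - 2 * Real.log x with hP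
  have hle : ∀ z ∈ Set.Ioo 0 (arcsinp p 1), P z ≤ 1 / p * Real.log (1 + sinhp p z ^ p) := by
    intro z hz
    obtain ⟨hs, hs2⟩ := aux_sinp p hB z hz
    obtain ⟨hy, hy2⟩ := aux_sinhp p hp z hz.1
    have hu := Real.rpow_pos_of_pos hy p
    have h1 := Real.log_le_log hs.1 (aux_sinp_le p hp hB z hz)
    have h2 := aux_lower p hp _ hy
    rw [hy2] at h2
    have h3 := Real.log_lt_log (by positivity) h2
    rw [Real.log_mul hy.ne' (by positivity), Real.log_rpow (by positivity)] at h3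
    simp only [hP]
    linarith
  have hx2 : x / 2 ∈ Set.Ioo 0 (arcsinp p 1) := ⟨by linarith [hx.1], by linarith [hx.1, hx.2]⟩
  have hlim : P (x / 2) ≤ 0 := by
    have ht : Tendsto (fun h : ℝ => 1 / p * Real.log (1 + h ^ p)) (𝓝[>] 0) (𝓝 0) := by
      have hc : ContinuousAt (fun h : ℝ => 1 / p * Real.log (1 + h ^ p)) 0 := by
        apply continuousAt_const.mul
        apply ContinuousAt.log
        · exact continuousAt_const.add (Real.continuousAt_rpow_const _ _ (Or.inr (by linarith)))
        · rw [Real.zero_rpow (by linarith)]; norm_num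
      have := hc.tendsto
      rw [Real.zero_rpow (by linarith)] at this
      simp only [add_zero, Real.log_one, mul_zero] at this
      exact this.mono_left nhdsWithin_le_nhds
    refine ge_of_tendsto ht ?_
    have hxp : 0 < x / 2 := hx2.1
    filter_upwards [Ioo_mem_nhdsGT hxp] with h hh
    have ha := aux_arsinhp_lt p hp h hh.1
    have ha0 := (aux_arsinhp_mono p hp) (Set.mem_Ici.mpr le_rfl) (Set.mem_Ici.mpr hh.1.le) hh.1
    rw [aux_arsinhp_zero] at ha0
    have hz : arsinhp p h ∈ Set.Ioo 0 (arcsinp p 1) := ⟨ha0, by linarith [hh.2, hx2.2]⟩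
    have h5 := hle _ hz
    have h6 := aux_sinhp p hp _ ha0
    have h7 : sinhp p (arsinhp p h) = h :=
      (aux_arsinhp_mono p hp).injOn (Set.mem_Ici.mpr h6.1.le) (Set.mem_Ici.mpr hh.1.le) h6.2
    rw [h7] at h5
    have h8 := hm hz hx2 (by linarith [hh.2])
    linarith
  have h := hm hx2 hx (by linarith [hx.1])
  obtain ⟨hs, hs2⟩ := aux_sinp p hB x hx
  obtain ⟨hy, hy2⟩ := aux_sinhp p hp x hx.1
  have hx0 := hx.1
  have hs1 := hs.1
  rw [← Real.log_lt_log_iff (by positivity) (by positivity), Real.log_mul hs.1.ne' hy.ne',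
    Real.log_mul hx0.ne' hx0.ne']
  have h9 : P x < 0 := lt_of_lt_of_le h hlim
  simp only [hP] at h9
  linarith

theorem stmt5 (p : ℝ) (hp : 2 ≤ p) :
    ∀ x ∈ Set.Ioo 0 (pip p / 2),
      (x / sinhp p x) ^ (1 + p) < 1 / coshp p x ∧
      1 / coshp p x < tanhp p x / x ∧
      tanhp p x / x < sinp p x / x ∧
      sinp p x / x < x / sinhp p x := by
  intro x hx
  have e : pip p / 2 = arcsinp p 1 := by simp [pip]
  rw [e] at hx
  have hB : 0 < arcsinp p 1 := hx.1.trans hx.2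
  have hx0 := hx.1
  obtain ⟨hy, hy2⟩ := aux_sinhp p hp x hx0
  have hu := Real.rpow_pos_of_pos hy p
  have hc : 0 < coshp p x := by unfold coshp; positivity
  have hT := aux_T_lt_sin p hp hB x hx
  have hinv : (1 + sinhp p x ^ p) ^ (-(1 / p)) = (coshp p x)⁻¹ := by
    rw [Real.rpow_neg (by positivity)]; rfl
  refine ⟨?_, ?_, ?_, ?_⟩
  · have h := aux_arsinhp_lt2 p hp _ hy
    rw [hy2] at h
    have h2 : x / sinhp p x < (1 + sinhp p x ^ p) ^ (-(1 / (p * (p + 1)))) := by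
      rw [div_lt_iff₀ hy]; linarith
    have h3 := Real.rpow_lt_rpow (by positivity) h2 (by linarith : 0 < 1 + p)
    rw [← Real.rpow_mul (by positivity)] at h3
    have e2 : -(1 / (p * (p + 1))) * (1 + p) = -(1 / p) := by
      field_simp
      ring
    rw [e2, hinv] at h3
    rw [one_div]
    exact h3
  · have h := aux_arsinhp_lt p hp _ hy
    rw [hy2] at h
    unfold tanhp
    rw [lt_div_iff₀ hx0, one_div_mul_eq_div]
    exact div_lt_div_of_pos_right h hc
  · apply div_lt_div_of_pos_right _ hx0
    rw [hinv] at hT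
    exact hT
  · rw [div_lt_div_iff₀ hx0 hy]
    exact aux_prod p hp hB x hx
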